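/- Let $d\ge 1$, $0<\lambda<d$, $\alpha>d/2$, and $b\in L^1(\mathbb{S}^{d-1})$ nonnegative. With $Q^-$ the loss operator, there exists a constant $C_-$ independent of $f,g$ such that for all $f,g\in L^1\cap\dot H^\alpha(\mathbb{R}^d)$, $\|Q^-(f,g)\|_{\dot H^\alpha} \le C_-\,\|b\|_{L^1(\mathbb{S}^{d-1})}\,\|f\|_{X^\alpha}\,\|g\|_{X^\alpha}$, where $\|h\|_{X^\alpha}=\max(\|h\|_{L^1},\|h\|_{\dot H^\alpha})$. -/

import Mathlib

open MeasureTheory FourierTransform ENNReal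
open scoped NNReal

noncomputable def L1e (d : ℕ) (f : EuclideanSpace ℝ (Fin d) → ℂ) : ℝ≥0∞ :=
  ∫⁻ v, ‖f v‖₊

noncomputable def He (d : ℕ) (s : ℝ) (f : EuclideanSpace ℝ (Fin d) → ℂ) : ℝ≥0∞ :=
  (∫⁻ ξ, (‖ξ‖₊ : ℝ≥0∞) ^ (2 * s) * (‖𝓕 f ξ‖₊ : ℝ≥0∞) ^ (2 : ℝ)) ^ ((1 : ℝ) / 2)

/-- The loss operator Q⁻ with fractional kernel, where c stands for ‖b‖_{L¹(S^{d-1})}. -/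
noncomputable def Qminus (d : ℕ) (c lam : ℝ)
    (f g : EuclideanSpace ℝ (Fin d) → ℂ) (v : EuclideanSpace ℝ (Fin d)) : ℂ :=
  (c : ℂ) * f v * ∫ w, ((‖v - w‖ ^ (-lam) : ℝ) : ℂ) * g w

/-- Surface measure on the unit sphere in ℝ^d. -/
noncomputable def sph (d : ℕ) : Measure (EuclideanSpace ℝ (Fin d)) :=
  (μH[(d : ℝ) - 1]).restrict (Metric.sphere 0 1)

open scoped RealInnerProductSpace in
noncomputable def bL1 (d : ℕ) (b : ℝ → ℝ) (k : EuclideanSpace ℝ (Fin d)) : ℝ≥0∞ :=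
  ∫⁻ σ, ENNReal.ofReal (b ⟪k, σ⟫) ∂sph d

/-- The X^α norm: max of the L¹ norm and the homogeneous Sobolev norm. -/
noncomputable def Xnorm (d : ℕ) (α : ℝ) (f : EuclideanSpace ℝ (Fin d) → ℂ) : ℝ≥0∞ :=
  max (L1e d f) (He d α f)

section Riesz

open Set Module
open scoped RealInnerProductSpace

variable {V : Type*} [NormedAddCommGroup V] [InnerProductSpace ℝ V] [FiniteDimensional ℝ V]
  [MeasurableSpace V] [BorelSpace V]

lemma integral_rpow_mul_exp_neg_mul_Ioi' {p r : ℝ} (hp : 0 < p) (hr : 0 < r) :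
    ∫ s in Ioi (0 : ℝ), s ^ (p - 1) * Real.exp (-(r * s)) = Real.Gamma p * r ^ (-p) := by
  rw [Real.integral_rpow_mul_exp_neg_mul_Ioi hp hr, one_div, Real.inv_rpow hr.le,
    Real.rpow_neg hr.le, mul_comm]

lemma integral_rpow_mul_exp_neg_div_Ioi {q r : ℝ} (hq : 0 < q) (hr : 0 < r) :
    ∫ s in Ioi (0 : ℝ), s ^ (-q - 1) * Real.exp (-(r / s)) = Real.Gamma q * r ^ (-q) := by
  rw [← integral_rpow_mul_exp_neg_mul_Ioi' hq hr,
    ← integral_comp_rpow_Ioi (fun s ↦ s ^ (q - 1) * Real.exp (-(r * s))) (p := -1) (by norm_num)]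
  refine setIntegral_congr_fun measurableSet_Ioi fun s (hs : 0 < s) ↦ ?_
  have h : s ^ (-q - 1) = s ^ ((-1 : ℝ) - 1) * (s ^ (-1 : ℝ)) ^ (q - 1) := by
    rw [← Real.rpow_mul hs.le, ← Real.rpow_add hs]
    ring_nf
  simp only [smul_eq_mul, h, Real.rpow_neg_one, div_eq_mul_inv]
  simp [mul_assoc]

/-- Superposition of kernels `K s`, with total weight `κ`, against a fixed function. -/
lemma integral_integral_kernel {S X : Type*} [MeasurableSpace S] [MeasurableSpace X]
    {μ : Measure S} {ν : Measure X} [SFinite μ] [SFinite ν] {K : S → X → ℝ}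
    (hK : Measurable (Function.uncurry K)) (hpos : ∀ x, ∀ᵐ s ∂μ, 0 ≤ K s x) {κ : X → ℝ}
    (hint : ∀ᵐ x ∂ν, Integrable (fun s ↦ K s x) μ) (hκ : ∀ᵐ x ∂ν, ∫ s, K s x ∂μ = κ x)
    {u : X → ℂ} (hu : AEStronglyMeasurable u ν)
    (hκu : Integrable (fun x ↦ (κ x : ℂ) * u x) ν) :
    ∫ s, ∫ x, (K s x : ℂ) * u x ∂ν ∂μ = ∫ x, (κ x : ℂ) * u x ∂ν := by
  have hm : AEStronglyMeasurable (Function.uncurry fun s x ↦ (K s x : ℂ) * u x) (μ.prod ν) := by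
    have hK' : AEStronglyMeasurable (fun q : S × X ↦ (K q.1 q.2 : ℂ)) (μ.prod ν) :=
      (Complex.measurable_ofReal.comp hK).aestronglyMeasurable
    exact hK'.mul hu.comp_snd
  rw [integral_integral_swap]
  · refine integral_congr_ae ?_
    filter_upwards [hκ] with x hx
    rw [integral_mul_const, integral_complex_ofReal, hx]
  · rw [integrable_prod_iff' hm]
    refine ⟨?_, hκu.norm.congr ?_⟩
    · filter_upwards [hint] with x hx using (hx.ofReal (𝕜 := ℂ)).mul_const (u x)
    · filter_upwards [hκ] with x hx
      have : ∫ s, ‖K s x‖ ∂μ = κ x := by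
        rw [← hx]
        refine integral_congr_ae ?_
        filter_upwards [hpos x] with s hs using Real.norm_of_nonneg hs
      have h0 : 0 ≤ κ x := this ▸ integral_nonneg fun s ↦ norm_nonneg _
      simp only [Function.uncurry_apply_pair, norm_mul, Complex.norm_real]
      rw [integral_mul_const, this, Real.norm_of_nonneg h0]

lemma integral_gaussian_mul_eq {g : V → ℂ} (hg : Integrable g) {s : ℝ} (hs : 0 < s) (v : V) :
    ((Real.pi / s) ^ (finrank ℝ V / 2 : ℝ) : ℝ) *
        ∫ w, (Real.exp (-(Real.pi ^ 2 * ‖v - w‖ ^ 2 / s)) : ℂ) * g w =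
      ∫ η, (Real.exp (-(‖η‖ ^ 2 * s)) : ℂ) * (Real.fourierChar ⟪η, v⟫ • 𝓕 g η) := by
  have hb : 0 < (s : ℂ).re := by simpa
  have hG := GaussianFourier.integrable_cexp_neg_mul_sq_norm_add hb
    (2 * Real.pi * Complex.I) v
  have key := VectorFourier.integral_fourierIntegral_smul_eq_flip (L := innerₗ V)
    (μ := volume) (ν := volume) Real.continuous_fourierChar continuous_inner hG hg
  rw [flip_innerₗ] at key
  have h1 : ∀ w, VectorFourier.fourierIntegral Real.fourierChar volume (innerₗ V)
      (fun v' ↦ Complex.exp (-(s : ℂ) * ‖v'‖ ^ 2 + 2 * Real.pi * Complex.I * ⟪v, v'⟫)) w =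
      ((Real.pi / s) ^ (finrank ℝ V / 2 : ℝ) : ℝ) *
        (Real.exp (-(Real.pi ^ 2 * ‖v - w‖ ^ 2 / s)) : ℂ) := by
    intro w
    refine (fourier_gaussian_innerProductSpace' hb v w).trans ?_
    rw [Complex.ofReal_cpow (by positivity)]
    push_cast
    ring_nf
  simp only [h1, smul_eq_mul] at key
  rw [← integral_const_mul]
  simp only [← mul_assoc]
  rw [key]
  refine integral_congr_ae (.of_forall fun η ↦ ?_)
  simp only [Circle.smul_def, Real.fourierChar_apply, smul_eq_mul, ← mul_assoc,
    Complex.ofReal_exp, ← Complex.exp_add]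
  rw [real_inner_comm]
  congr 2
  push_cast
  ring

variable [Nontrivial V]

/-- The Fourier transform of the Riesz kernel, tested against an integrable function. -/
lemma integral_riesz_kernel_mul {lam : ℝ} (h0 : 0 < lam) (hd : lam < finrank ℝ V) {g : V → ℂ}
    (hg : Integrable g) (v : V)
    (hgv : Integrable fun w ↦ ((‖v - w‖ ^ (-lam) : ℝ) : ℂ) * g w)
    (hĝ : Integrable fun η : V ↦ ((‖η‖ ^ (lam - finrank ℝ V) : ℝ) : ℂ) * 𝓕 g η) :
    ((Real.Gamma (lam / 2) * Real.pi ^ (finrank ℝ V / 2 - lam) : ℝ) : ℂ) *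
        ∫ w, ((‖v - w‖ ^ (-lam) : ℝ) : ℂ) * g w =
      (Real.Gamma ((finrank ℝ V - lam) / 2) : ℂ) *
        ∫ η, ((‖η‖ ^ (lam - finrank ℝ V) : ℝ) : ℂ) * (Real.fourierChar ⟪η, v⟫ • 𝓕 g η) := by
  set n : ℝ := (finrank ℝ V : ℝ)
  set p : ℝ := (n - lam) / 2
  have hp : 0 < p := by simp only [p]; linarith
  have hq : 0 < lam / 2 := by positivity
  have hĝc : Continuous (𝓕 g) :=
    VectorFourier.fourierIntegral_continuous Real.continuous_fourierChar continuous_inner hg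
  have hκ₁ : ∀ η : V, η ≠ 0 → ∫ s in Ioi (0 : ℝ), s ^ (p - 1) * Real.exp (-(‖η‖ ^ 2 * s)) =
      Real.Gamma p * ‖η‖ ^ (lam - n) := by
    intro η hη
    have : 0 < ‖η‖ := norm_pos_iff.2 hη
    rw [integral_rpow_mul_exp_neg_mul_Ioi' hp (by positivity), ← Real.rpow_natCast,
      ← Real.rpow_mul this.le]
    simp only [p]
    ring_nf
  have hκ₂ : ∀ w : V, w ≠ v → ∫ s in Ioi (0 : ℝ), s ^ (-(lam / 2) - 1) *
      Real.exp (-(Real.pi ^ 2 * ‖v - w‖ ^ 2 / s)) =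
      Real.Gamma (lam / 2) * Real.pi ^ (-lam) * ‖v - w‖ ^ (-lam) := by
    intro w hw
    have h : 0 < ‖v - w‖ := norm_pos_iff.2 (sub_ne_zero.2 hw.symm)
    rw [integral_rpow_mul_exp_neg_div_Ioi hq (by positivity), ← mul_pow, ← Real.rpow_natCast,
      ← Real.rpow_mul (by positivity), Real.mul_rpow Real.pi_pos.le h.le]
    ring_nf
  have key₁ := integral_integral_kernel (μ := volume.restrict (Ioi (0 : ℝ))) (ν := volume)
    (K := fun s (η : V) ↦ s ^ (p - 1) * Real.exp (-(‖η‖ ^ 2 * s)))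
    (κ := fun η ↦ Real.Gamma p * ‖η‖ ^ (lam - n))
    (u := fun η ↦ Real.fourierChar ⟪η, v⟫ • 𝓕 g η) (by fun_prop)
    (fun η ↦ by
      filter_upwards [ae_restrict_mem measurableSet_Ioi] with s (hs : 0 < s)
      positivity)
    (by
      filter_upwards [Measure.ae_ne volume (0 : V)] with η hη
      refine not_imp_comm.1 integral_undef ?_
      rw [hκ₁ η hη]
      have : 0 < ‖η‖ := norm_pos_iff.2 hη
      have := Real.Gamma_pos_of_pos hp
      positivity)
    (by filter_upwards [Measure.ae_ne volume (0 : V)] with η hη using hκ₁ η hη)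
    (by
      refine Continuous.aestronglyMeasurable ?_
      exact (Real.continuous_fourierChar.comp (by fun_prop)).smul hĝc)
    (by
      have := (hĝ.const_mul (Real.Gamma p : ℂ)).bdd_mul (c := 1)
        (f := fun η ↦ (Real.fourierChar ⟪η, v⟫ : ℂ))
        (Continuous.aestronglyMeasurable
          (continuous_subtype_val.comp (Real.continuous_fourierChar.comp (by fun_prop))))
        (.of_forall fun η ↦ (Circle.norm_coe _).le)
      refine this.congr (.of_forall fun η ↦ ?_)
      simp only [Circle.smul_def, smul_eq_mul]
      push_cast
      ring)
  have key₂ := integral_integral_kernel (μ := volume.restrict (Ioi (0 : ℝ))) (ν := volume)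
    (K := fun s (w : V) ↦ s ^ (-(lam / 2) - 1) * Real.exp (-(Real.pi ^ 2 * ‖v - w‖ ^ 2 / s)))
    (κ := fun w ↦ Real.Gamma (lam / 2) * Real.pi ^ (-lam) * ‖v - w‖ ^ (-lam))
    (u := g) (by fun_prop)
    (fun η ↦ by
      filter_upwards [ae_restrict_mem measurableSet_Ioi] with s (hs : 0 < s)
      positivity)
    (by
      filter_upwards [Measure.ae_ne volume v] with w hw
      refine not_imp_comm.1 integral_undef ?_
      rw [hκ₂ w hw]
      have h : 0 < ‖v - w‖ := norm_pos_iff.2 (sub_ne_zero.2 hw.symm)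
      have := Real.Gamma_pos_of_pos hq
      positivity)
    (by filter_upwards [Measure.ae_ne volume v] with w hw using hκ₂ w hw)
    hg.1
    (by
      refine (hgv.const_mul ((Real.Gamma (lam / 2) * Real.pi ^ (-lam) : ℝ) : ℂ)).congr
        (.of_forall fun η ↦ ?_)
      push_cast
      ring)
  have hl : ((Real.Gamma (lam / 2) * Real.pi ^ (n / 2 - lam) : ℝ) : ℂ) *
        ∫ w, ((‖v - w‖ ^ (-lam) : ℝ) : ℂ) * g w = ((Real.pi ^ (n / 2) : ℝ) : ℂ) *
        ∫ w, ((Real.Gamma (lam / 2) * Real.pi ^ (-lam) * ‖v - w‖ ^ (-lam) : ℝ) : ℂ) * g w := by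
    rw [sub_eq_add_neg, Real.rpow_add Real.pi_pos, ← integral_const_mul, ← integral_const_mul]
    congr with w
    push_cast
    ring
  have hr : (Real.Gamma p : ℂ) *
        ∫ η, ((‖η‖ ^ (lam - n) : ℝ) : ℂ) * (Real.fourierChar ⟪η, v⟫ • 𝓕 g η) =
        ∫ η, ((Real.Gamma p * ‖η‖ ^ (lam - n) : ℝ) : ℂ) *
          (Real.fourierChar ⟪η, v⟫ • 𝓕 g η) := by
    rw [← integral_const_mul]
    congr with w
    push_cast
    ring
  rw [hl, hr, ← key₁, ← key₂, ← integral_const_mul]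
  refine setIntegral_congr_fun measurableSet_Ioi fun s (hs : 0 < s) ↦ ?_
  have h1 := integral_gaussian_mul_eq hg hs v
  have h2 : s ^ (p - 1) * (Real.pi / s) ^ (n / 2) = Real.pi ^ (n / 2) * s ^ (-(lam / 2) - 1) := by
    rw [Real.div_rpow Real.pi_pos.le hs.le, div_eq_mul_inv, ← Real.rpow_neg hs.le, mul_left_comm,
      ← Real.rpow_add hs]
    simp only [p]
    ring_nf
  simp only [Complex.ofReal_mul, mul_assoc, integral_const_mul]
  rw [← h1, ← mul_assoc, ← mul_assoc, ← Complex.ofReal_mul, ← Complex.ofReal_mul, h2]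

end Riesz

section Weights

open Set Module Metric
open scoped RealInnerProductSpace

lemma ofReal_norm_rpow_le {W : Type*} [NormedAddCommGroup W] (s : ℝ) (x : W) : ENNReal.ofReal (‖x‖ ^ s) ≤ ‖x‖ₑ ^ s := by
  rcases eq_or_ne x 0 with rfl | hx
  · rcases lt_trichotomy s 0 with hs | rfl | hs
    · simp [ENNReal.zero_rpow_of_neg hs]
    · simp
    · simp [Real.zero_rpow hs.ne']
  · rw [← ofReal_norm, ENNReal.ofReal_rpow_of_pos (norm_pos_iff.2 hx)]

lemma enorm_rpow_le_mul_add {W : Type*} [NormedAddCommGroup W] {α : ℝ} (hα : 0 ≤ α) (ξ η : W) :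
    ‖ξ‖ₑ ^ α ≤ 2 ^ α * (‖η‖ₑ ^ α + ‖ξ - η‖ₑ ^ α) := by
  have h : ‖ξ‖ₑ ≤ 2 * max ‖η‖ₑ ‖ξ - η‖ₑ := by
    calc ‖ξ‖ₑ = ‖η + (ξ - η)‖ₑ := by rw [add_sub_cancel]
      _ ≤ ‖η‖ₑ + ‖ξ - η‖ₑ := enorm_add_le _ _
      _ ≤ _ := by
        rw [two_mul]
        exact add_le_add (le_max_left _ _) (le_max_right _ _)
  refine (ENNReal.rpow_le_rpow h hα).trans ?_
  rw [ENNReal.mul_rpow_of_nonneg _ _ hα]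
  gcongr
  rcases max_choice ‖η‖ₑ ‖ξ - η‖ₑ with h | h <;> rw [h]
  exacts [le_self_add, le_add_self]

variable {V : Type*} [NormedAddCommGroup V] [InnerProductSpace ℝ V] [FiniteDimensional ℝ V]
  [MeasurableSpace V] [BorelSpace V]

lemma setLIntegral_compl_ball_enorm_rpow_lt_top {r : ℝ} (hr : finrank ℝ V < r) :
    ∫⁻ x in (ball (0 : V) 1)ᶜ, ‖x‖ₑ ^ (-r) < ⊤ := by
  have hr0 : 0 < r := (Nat.cast_nonneg _).trans_lt hr
  have h := ((integrable_one_add_norm (E := V) (μ := volume) hr).const_mul (2 ^ r)).2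
  refine lt_of_le_of_lt ?_ h
  refine (setLIntegral_mono' measurableSet_ball.compl fun x hx ↦ ?_).trans
    (setLIntegral_le_lintegral _ _)
  have hx1 : 1 ≤ ‖x‖ := by simpa using hx
  have hx0 : 0 < ‖x‖ := by linarith
  rw [← ofReal_norm, ENNReal.ofReal_rpow_of_pos hx0, Real.enorm_of_nonneg (by positivity)]
  refine ENNReal.ofReal_le_ofReal ?_
  change _ ≤ 2 ^ r * (1 + ‖x‖) ^ (-r)
  rw [Real.rpow_neg hx0.le, Real.rpow_neg (by positivity), ← div_eq_mul_inv,
    ← Real.div_rpow (by positivity) (by positivity), inv_eq_one_div, ← Real.one_rpow r,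
    ← Real.div_rpow (by positivity) (by positivity), Real.one_rpow]
  refine Real.rpow_le_rpow (by positivity) ?_ hr0.le
  rw [div_le_div_iff₀ hx0 (by positivity)]
  linarith

lemma lintegral_enorm_rpow_mul_sq_le {s α : ℝ} (hs : s ≤ 2 * α) {φ : V → ℝ≥0∞}
    {X : ℝ≥0∞} (hX : ∀ x, φ x ≤ X)
    (hX' : ∫⁻ x, ‖x‖ₑ ^ (2 * α) * φ x ^ 2 ≤ X ^ 2) :
    ∫⁻ x, ‖x‖ₑ ^ s * φ x ^ 2 ≤ ((∫⁻ x in ball (0 : V) 1, ‖x‖ₑ ^ s) + 1) * X ^ 2 := by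
  rw [← lintegral_add_compl _ (measurableSet_ball (x := (0 : V)) (ε := 1)), add_mul, one_mul]
  refine add_le_add ?_ ?_
  · rw [← lintegral_mul_const _ (by fun_prop)]
    gcongr
    exact hX _
  · refine (setLIntegral_mono' measurableSet_ball.compl fun x hx ↦ ?_).trans
      ((setLIntegral_le_lintegral _ _).trans hX')
    have hx1 : 1 ≤ ‖x‖ₑ := by
      rw [← ofReal_norm, ENNReal.one_le_ofReal]
      simpa using hx
    gcongr

lemma lintegral_enorm_rpow_mul_le {s α : ℝ} (hs : s ≤ 0) {φ : V → ℝ≥0∞}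
    (hφ : Measurable φ) {X : ℝ≥0∞} (hX : ∀ x, φ x ≤ X)
    (hX' : ∫⁻ x, ‖x‖ₑ ^ (2 * α) * φ x ^ 2 ≤ X ^ 2) :
    ∫⁻ x, ‖x‖ₑ ^ s * φ x ≤ ((∫⁻ x in ball (0 : V) 1, ‖x‖ₑ ^ s) +
      (∫⁻ x in (ball (0 : V) 1)ᶜ, ‖x‖ₑ ^ (-(2 * α))) ^ (1 / 2 : ℝ)) * X := by
  rw [← lintegral_add_compl _ (measurableSet_ball (x := (0 : V)) (ε := 1)), add_mul]
  refine add_le_add ?_ ?_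
  · rw [← lintegral_mul_const _ (by fun_prop)]
    gcongr
    exact hX _
  · have hpow (x : V) (t : ℝ) : (‖x‖ₑ ^ t) ^ 2 = ‖x‖ₑ ^ (2 * t) := by
      rw [← ENNReal.rpow_two, ← ENNReal.rpow_mul, mul_comm]
    calc ∫⁻ x in (ball (0 : V) 1)ᶜ, ‖x‖ₑ ^ s * φ x
        ≤ ∫⁻ x in (ball (0 : V) 1)ᶜ,
            ((fun x : V ↦ ‖x‖ₑ ^ (-α)) * fun x : V ↦ ‖x‖ₑ ^ α * φ x : V → ℝ≥0∞) x := by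
          refine setLIntegral_mono' measurableSet_ball.compl fun x hx ↦ ?_
          have hx1 : 1 ≤ ‖x‖ₑ := by
            rw [← ofReal_norm, ENNReal.one_le_ofReal]
            simpa using hx
          have h0 : ‖x‖ₑ ≠ 0 := (zero_lt_one.trans_le hx1).ne'
          rw [Pi.mul_apply, ← mul_assoc, ← ENNReal.rpow_add _ _ h0 enorm_ne_top, neg_add_cancel]
          gcongr
      _ ≤ (∫⁻ x in (ball (0 : V) 1)ᶜ, (‖x‖ₑ ^ (-α)) ^ (2 : ℝ)) ^ (1 / 2 : ℝ) *
          (∫⁻ x in (ball (0 : V) 1)ᶜ, (‖x‖ₑ ^ α * φ x) ^ (2 : ℝ)) ^ (1 / 2 : ℝ) :=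
          ENNReal.lintegral_mul_le_Lp_mul_Lq _ Real.HolderConjugate.two_two
            (by fun_prop) (by fun_prop)
      _ ≤ _ := by
          simp only [ENNReal.rpow_two, mul_pow, hpow, mul_neg]
          gcongr
          calc _ ≤ (X ^ 2) ^ (1 / 2 : ℝ) := by
                gcongr
                exact (setLIntegral_le_lintegral _ _).trans hX'
            _ = X := by
                rw [← ENNReal.rpow_two, ← ENNReal.rpow_mul]
                norm_num

/-- Young's inequality for an `L¹` function and an `L²` function. -/
lemma lintegral_sq_lintegral_mul_le {H F : V → ℝ≥0∞} (hH : Measurable H) (hF : Measurable F) :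
    ∫⁻ ξ, (∫⁻ η, H η * F (ξ - η)) ^ 2 ≤ (∫⁻ η, H η) ^ 2 * ∫⁻ ξ, F ξ ^ 2 := by
  have hpow (x : ℝ≥0∞) : (x ^ (1 / 2 : ℝ)) ^ (2 : ℝ) = x := by
    rw [← ENNReal.rpow_mul]
    norm_num
  have h1 (ξ : V) : (∫⁻ η, H η * F (ξ - η)) ^ 2 ≤ (∫⁻ η, H η) * ∫⁻ η, H η * F (ξ - η) ^ 2 := by
    have := ENNReal.lintegral_mul_le_Lp_mul_Lq (volume : Measure V) Real.HolderConjugate.two_two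
      (f := fun η ↦ H η ^ (1 / 2 : ℝ)) (g := fun η ↦ H η ^ (1 / 2 : ℝ) * F (ξ - η))
      (by fun_prop) (by fun_prop)
    have h2 : ∀ η, ((fun η ↦ H η ^ (1 / 2 : ℝ)) * fun η ↦ H η ^ (1 / 2 : ℝ) * F (ξ - η)) η =
        H η * F (ξ - η) := by
      intro η
      rw [Pi.mul_apply, ← mul_assoc, ← ENNReal.rpow_add_of_nonneg _ _ (by norm_num) (by norm_num)]
      norm_num
    simp only [h2, ENNReal.mul_rpow_of_nonneg _ _ zero_le_two, hpow] at this
    refine (pow_le_pow_left' this 2).trans_eq ?_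
    rw [mul_pow, ← ENNReal.rpow_two, ← ENNReal.rpow_two, hpow, hpow]
    simp only [ENNReal.rpow_two]
  calc ∫⁻ ξ, (∫⁻ η, H η * F (ξ - η)) ^ 2
      ≤ ∫⁻ ξ, (∫⁻ η, H η) * ∫⁻ η, H η * F (ξ - η) ^ 2 := lintegral_mono h1
    _ = (∫⁻ η, H η) * ∫⁻ ξ, ∫⁻ η, H η * F (ξ - η) ^ 2 :=
        lintegral_const_mul _ (Measurable.lintegral_prod_right (by fun_prop))
    _ = (∫⁻ η, H η) * ∫⁻ η, ∫⁻ ξ, H η * F (ξ - η) ^ 2 := by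
        rw [lintegral_lintegral_swap (by fun_prop)]
    _ = (∫⁻ η, H η) * ∫⁻ η, H η * ∫⁻ ξ, F ξ ^ 2 := by
        congr with η
        rw [lintegral_const_mul _ (by fun_prop), lintegral_sub_right_eq_self (fun ξ ↦ F ξ ^ 2)]
    _ = _ := by
        rw [lintegral_mul_const _ hH]
        ring

lemma lintegral_enorm_rpow_mul_sq_lintegral_le {α : ℝ} (hα : 0 ≤ α) {H F : V → ℝ≥0∞}
    (hH : Measurable H) (hF : Measurable F) :
    ∫⁻ ξ, ‖ξ‖ₑ ^ (2 * α) * (∫⁻ η, H η * F (ξ - η)) ^ 2 ≤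
      (2 ^ α) ^ 2 * 2 * ((∫⁻ ξ, F ξ) ^ 2 * ∫⁻ η, ‖η‖ₑ ^ (2 * α) * H η ^ 2) +
      (2 ^ α) ^ 2 * 2 * ((∫⁻ η, H η) ^ 2 * ∫⁻ ξ, ‖ξ‖ₑ ^ (2 * α) * F ξ ^ 2) := by
  have hpow (x : V) : ‖x‖ₑ ^ (2 * α) = (‖x‖ₑ ^ α) ^ 2 := by
    rw [← ENNReal.rpow_two, ← ENNReal.rpow_mul, mul_comm]
  simp only [hpow, ← mul_pow]
  have h1 (ξ : V) : ‖ξ‖ₑ ^ α * ∫⁻ η, H η * F (ξ - η) ≤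
      2 ^ α * ((∫⁻ η, F η * (‖ξ - η‖ₑ ^ α * H (ξ - η))) +
        ∫⁻ η, H η * (‖ξ - η‖ₑ ^ α * F (ξ - η))) := by
    have : ∫⁻ η, F η * (‖ξ - η‖ₑ ^ α * H (ξ - η)) = ∫⁻ η, F (ξ - η) * (‖η‖ₑ ^ α * H η) := by
      rw [← lintegral_sub_left_eq_self _ ξ]
      simp
    rw [this, ← lintegral_add_left (by fun_prop), ← lintegral_const_mul _ (by fun_prop),
      ← lintegral_const_mul _ (by fun_prop)]
    refine lintegral_mono fun η ↦ ?_
    refine (mul_le_mul_left (enorm_rpow_le_mul_add hα ξ η) _).trans_eq ?_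
    ring
  have h2 (a b : ℝ≥0∞) : (a + b) ^ 2 ≤ 2 * a ^ 2 + 2 * b ^ 2 := by
    have := ENNReal.rpow_add_le_mul_rpow_add_rpow a b one_le_two
    norm_num [mul_add] at this
    exact this
  calc ∫⁻ ξ, (‖ξ‖ₑ ^ α * ∫⁻ η, H η * F (ξ - η)) ^ 2
      ≤ ∫⁻ ξ, ((2 ^ α) ^ 2 * 2 * (∫⁻ η, F η * (‖ξ - η‖ₑ ^ α * H (ξ - η))) ^ 2 +
          (2 ^ α) ^ 2 * 2 * (∫⁻ η, H η * (‖ξ - η‖ₑ ^ α * F (ξ - η))) ^ 2) := by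
        refine lintegral_mono fun ξ ↦ (pow_le_pow_left' (h1 ξ) 2).trans ?_
        rw [mul_pow, mul_assoc, mul_assoc, ← mul_add]
        gcongr
        exact h2 _ _
    _ ≤ _ := by
        have hm1 : Measurable fun ξ : V ↦ ∫⁻ η, F η * (‖ξ - η‖ₑ ^ α * H (ξ - η)) :=
          Measurable.lintegral_prod_right (by fun_prop)
        have hm2 : Measurable fun ξ : V ↦ ∫⁻ η, H η * (‖ξ - η‖ₑ ^ α * F (ξ - η)) :=
          Measurable.lintegral_prod_right (by fun_prop)
        rw [lintegral_add_left (by fun_prop), lintegral_const_mul _ (by fun_prop),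
          lintegral_const_mul _ (by fun_prop)]
        gcongr
        · exact lintegral_sq_lintegral_mul_le hF (F := fun η ↦ ‖η‖ₑ ^ α * H η) (by fun_prop)
        · exact lintegral_sq_lintegral_mul_le hH (F := fun η ↦ ‖η‖ₑ ^ α * F η) (by fun_prop)

variable [Nontrivial V]

lemma integrableOn_ball_norm_rpow {s : ℝ} (hs : -finrank ℝ V < s) :
    IntegrableOn (fun x : V ↦ ‖x‖ ^ s) (ball 0 1) := by
  rw [integrableOn_fun_norm_addHaar volume (f := fun r ↦ r ^ s)]
  have hn : 1 ≤ finrank ℝ V := finrank_pos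
  refine ((intervalIntegral.integrableOn_Ioo_rpow_iff (s := finrank ℝ V - 1 + s) one_pos).2
    (by linarith)).congr_fun (fun r hr ↦ ?_) measurableSet_Ioo
  simp only [smul_eq_mul]
  rw [← Real.rpow_natCast, ← Real.rpow_add hr.1, Nat.cast_sub hn, Nat.cast_one]

lemma setLIntegral_ball_enorm_rpow_lt_top {s : ℝ} (hs : -finrank ℝ V < s) :
    ∫⁻ x in ball (0 : V) 1, ‖x‖ₑ ^ s < ⊤ := by
  refine (integrableOn_ball_norm_rpow hs).2.trans_le' (lintegral_mono_ae ?_)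
  filter_upwards [ae_restrict_of_ae (Measure.ae_ne volume (0 : V))] with x hx
  rw [Real.enorm_of_nonneg (by positivity), ← ofReal_norm,
    ENNReal.ofReal_rpow_of_pos (norm_pos_iff.2 hx)]

lemma ae_integrable_riesz_kernel_mul {lam : ℝ} (h0 : 0 < lam) (hd : lam < finrank ℝ V)
    {g : V → ℂ} (hg : Integrable g) :
    ∀ᵐ v : V, Integrable fun w ↦ ((‖v - w‖ ^ (-lam) : ℝ) : ℂ) * g w := by
  have h1 : Integrable ((ball (0 : V) 1).indicator fun x ↦ ((‖x‖ ^ (-lam) : ℝ) : ℂ)) :=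
    (integrable_indicator_iff measurableSet_ball).2
      (integrableOn_ball_norm_rpow (by linarith)).ofReal
  filter_upwards [hg.ae_convolution_exists (ContinuousLinearMap.mul ℂ ℂ) h1] with v hv
  have h2 : Integrable fun w ↦
      ((ball (0 : V) 1)ᶜ.indicator fun x ↦ ((‖x‖ ^ (-lam) : ℝ) : ℂ)) (v - w) * g w := by
    refine hg.bdd_mul (c := 1) ?_ (.of_forall fun w ↦ ?_)
    · refine Measurable.aestronglyMeasurable ?_
      exact (Measurable.indicator (by fun_prop) measurableSet_ball.compl).comp
        (measurable_const.sub measurable_id)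
    · by_cases hw : v - w ∈ (ball (0 : V) 1)ᶜ
      · rw [indicator_of_mem hw, Complex.norm_real, Real.norm_of_nonneg (by positivity)]
        exact Real.rpow_le_one_of_one_le_of_nonpos (by simpa using hw) (by linarith)
      · simp [indicator_of_notMem hw]
  refine (Integrable.add hv h2).congr (.of_forall fun w ↦ ?_)
  simp only [Pi.add_apply, ContinuousLinearMap.mul_apply']
  rw [mul_comm (g w), ← add_mul, ← Pi.add_apply, indicator_self_add_compl]

end Weights

section Product

open Set Module Metric
open scoped RealInnerProductSpace

variable {V : Type*} [NormedAddCommGroup V] [InnerProductSpace ℝ V] [FiniteDimensional ℝ V]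
  [MeasurableSpace V] [BorelSpace V]

lemma fourier_mul_fourierInv {f h : V → ℂ} (hf : Integrable f) (hh : Integrable h) (ξ : V) :
    𝓕 (fun v ↦ f v * 𝓕⁻ h v) ξ = ∫ η, h η * 𝓕 f (ξ - η) := by
  have hfξ : Integrable fun v ↦ Real.fourierChar (-⟪v, ξ⟫) • f v :=
    (Real.fourierIntegral_convergent_iff ξ).2 hf
  have key := VectorFourier.integral_fourierIntegral_smul_eq_flip (L := innerₗ V)
    (μ := volume) (ν := volume) Real.continuous_fourierChar continuous_inner hfξ hh.comp_neg
  rw [flip_innerₗ] at key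
  have h1 (η : V) : VectorFourier.fourierIntegral Real.fourierChar volume (innerₗ V)
      (fun v ↦ Real.fourierChar (-⟪v, ξ⟫) • f v) η = 𝓕 f (ξ + η) := by
    rw [Real.fourier_eq]
    refine integral_congr_ae (.of_forall fun v ↦ ?_)
    simp only [smul_smul, ← AddChar.map_add_eq_mul, innerₗ_apply_apply, inner_add_right]
    ring_nf
  have h2 (v : V) : VectorFourier.fourierIntegral Real.fourierChar volume (innerₗ V)
      (fun η ↦ h (-η)) v = 𝓕⁻ h v := by
    rw [Real.fourierInv_eq_fourier_comp_neg]
    rfl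
  simp only [h1, h2, smul_eq_mul] at key
  rw [Real.fourier_eq, ← integral_neg_eq_self fun η ↦ h η * 𝓕 f (ξ - η)]
  simp only [sub_neg_eq_add, mul_comm (h _)]
  rw [key]
  simp only [Circle.smul_def, smul_eq_mul, mul_assoc]

lemma enorm_fourier_le (f : V → ℂ) (ξ : V) : ‖𝓕 f ξ‖ₑ ≤ ∫⁻ v, ‖f v‖ₑ := by
  rw [Real.fourier_eq]
  refine (enorm_integral_le_lintegral_enorm _).trans_eq ?_
  congr with v
  rw [← ofReal_norm, Circle.norm_smul, ofReal_norm]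

lemma continuous_fourier_of_integrable {f : V → ℂ} (hf : Integrable f) : Continuous (𝓕 f) :=
  VectorFourier.fourierIntegral_continuous Real.continuous_fourierChar continuous_inner hf

variable [Nontrivial V]

lemma ae_riesz_potential_eq_fourierInv {lam : ℝ} (h0 : 0 < lam) (hd : lam < finrank ℝ V)
    {g : V → ℂ} (hg : Integrable g)
    (hĝ : Integrable fun η : V ↦ ((‖η‖ ^ (lam - finrank ℝ V) : ℝ) : ℂ) * 𝓕 g η) :
    ∀ᵐ v : V, ∫ w, ((‖v - w‖ ^ (-lam) : ℝ) : ℂ) * g w =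
      ((Real.Gamma ((finrank ℝ V - lam) / 2) /
        (Real.Gamma (lam / 2) * Real.pi ^ (finrank ℝ V / 2 - lam)) : ℝ) : ℂ) *
      𝓕⁻ (fun η : V ↦ ((‖η‖ ^ (lam - finrank ℝ V) : ℝ) : ℂ) * 𝓕 g η) v := by
  filter_upwards [ae_integrable_riesz_kernel_mul h0 hd hg] with v hv
  have key := integral_riesz_kernel_mul h0 hd hg v hv hĝ
  have hpos : 0 < Real.Gamma (lam / 2) * Real.pi ^ (finrank ℝ V / 2 - lam) := by
    have := Real.Gamma_pos_of_pos (half_pos h0)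
    positivity
  rw [Complex.ofReal_div, div_mul_eq_mul_div,
    eq_div_iff (Complex.ofReal_ne_zero.2 hpos.ne'), mul_comm, key, Real.fourierInv_eq]
  simp only [mul_smul_comm]

end Product

lemma He_sq (d : ℕ) (s : ℝ) (f : EuclideanSpace ℝ (Fin d) → ℂ) :
    He d s f ^ 2 = ∫⁻ ξ, ‖ξ‖ₑ ^ (2 * s) * ‖𝓕 f ξ‖ₑ ^ 2 := by
  rw [He, ← ENNReal.rpow_two, ← ENNReal.rpow_mul]
  norm_num
  rfl

lemma He_const_mul (d : ℕ) (s : ℝ) (c : ℂ) (f : EuclideanSpace ℝ (Fin d) → ℂ) :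
    He d s (fun v ↦ c * f v) = ‖c‖ₑ * He d s f := by
  have h (ξ : EuclideanSpace ℝ (Fin d)) : 𝓕 (fun v ↦ c * f v) ξ = c * 𝓕 f ξ := by
    rw [Real.fourier_eq, Real.fourier_eq, ← integral_const_mul]
    simp only [Circle.smul_def, smul_eq_mul, mul_left_comm]
  refine (ENNReal.pow_right_strictMono two_ne_zero).injective ?_
  simp only [mul_pow, He_sq, h, enorm_mul]
  rw [← lintegral_const_mul' _ _ (by simp)]
  simp only [mul_left_comm]

/-- The estimate for the loss operator without its angular factor. -/
lemma exists_He_mul_riesz_le (d : ℕ) (hd : 1 ≤ d) (lam α : ℝ) (hlam0 : 0 < lam) (hlamd : lam < d)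
    (hα : (d : ℝ) / 2 < α) :
    ∃ C : ℝ≥0∞, C ≠ ⊤ ∧ ∀ f g : EuclideanSpace ℝ (Fin d) → ℂ, Integrable f → Integrable g →
      He d α g ≠ ⊤ →
      He d α (fun v ↦ f v * ∫ w, ((‖v - w‖ ^ (-lam) : ℝ) : ℂ) * g w) ≤
        C * Xnorm d α f * Xnorm d α g := by
  have : NeZero d := ⟨by lia⟩
  set V := EuclideanSpace ℝ (Fin d)
  have hn : Module.finrank ℝ V = d := finrank_euclideanSpace_fin
  have hα0 : 0 ≤ α := by
    have : (0 : ℝ) ≤ d / 2 := by positivity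
    linarith
  let M : ℝ → ℝ≥0∞ := fun s ↦ ∫⁻ x in Metric.ball (0 : V) 1, ‖x‖ₑ ^ s
  have hM {s : ℝ} (hs : -d < s) : M s ≠ ⊤ :=
    (setLIntegral_ball_enorm_rpow_lt_top (by rwa [hn])).ne
  let N : ℝ≥0∞ := (∫⁻ x in (Metric.ball (0 : V) 1)ᶜ, ‖x‖ₑ ^ (-(2 * α))) ^ (1 / 2 : ℝ)
  have hN : N ≠ ⊤ := by
    refine ENNReal.rpow_ne_top_of_nonneg (by norm_num) ?_
    exact (setLIntegral_compl_ball_enorm_rpow_lt_top (by rw [hn]; linarith)).ne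
  let A : ℝ := Real.Gamma ((d - lam) / 2) / (Real.Gamma (lam / 2) * Real.pi ^ ((d : ℝ) / 2 - lam))
  let C₁ : ℝ≥0∞ := M 0 + N
  let C₂ : ℝ≥0∞ := ‖A‖ₑ * (M (lam - d) + N)
  let C₃ : ℝ≥0∞ := ‖A‖ₑ ^ 2 * (M (2 * (α + (lam - d))) + 1)
  let C₄ : ℝ≥0∞ := (2 ^ α) ^ 2 * 2 * (C₁ ^ 2 * C₃) + (2 ^ α) ^ 2 * 2 * C₂ ^ 2
  have h2 : (2 : ℝ≥0∞) ^ α ≠ ⊤ := ENNReal.rpow_ne_top_of_nonneg hα0 (by simp)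
  have hC₁ : C₁ ≠ ⊤ := ENNReal.add_ne_top.2 ⟨hM (by simp; lia), hN⟩
  have hC₂ : C₂ ≠ ⊤ :=
    ENNReal.mul_ne_top enorm_ne_top (ENNReal.add_ne_top.2 ⟨hM (by linarith), hN⟩)
  have hC₃ : C₃ ≠ ⊤ := ENNReal.mul_ne_top (by simp)
    (ENNReal.add_ne_top.2 ⟨hM (by linarith), by simp⟩)
  have hC₄ : C₄ ≠ ⊤ := by
    simp only [C₄]
    finiteness
  refine ⟨C₄ ^ (1 / 2 : ℝ), ENNReal.rpow_ne_top_of_nonneg (by norm_num) hC₄,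
    fun f g hf hg hgα ↦ ?_⟩
  have hX (u : V → ℂ) (ξ : V) : ‖𝓕 u ξ‖ₑ ≤ Xnorm d α u :=
    (enorm_fourier_le u ξ).trans (le_max_left _ _)
  have hX' (u : V → ℂ) : ∫⁻ ξ, ‖ξ‖ₑ ^ (2 * α) * ‖𝓕 u ξ‖ₑ ^ 2 ≤ Xnorm d α u ^ 2 := by
    rw [← He_sq]
    exact pow_le_pow_left' (le_max_right _ _) 2
  have hXg : Xnorm d α g ≠ ⊤ := by
    refine (max_lt ?_ hgα.lt_top).ne
    exact hg.2
  have hfc := continuous_fourier_of_integrable hf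
  have hgc := continuous_fourier_of_integrable hg
  let H : V → ℝ≥0∞ := fun η ↦ ‖A‖ₑ * (‖η‖ₑ ^ (lam - d) * ‖𝓕 g η‖ₑ)
  have hHm : Measurable H := by fun_prop
  have hF1 : ∫⁻ ξ, ‖𝓕 f ξ‖ₑ ≤ C₁ * Xnorm d α f := by
    refine le_trans (le_of_eq ?_)
      (lintegral_enorm_rpow_mul_le (le_refl 0) hfc.enorm.measurable (hX f) (hX' f))
    simp
  have hG1 : ∫⁻ η : V, ‖η‖ₑ ^ (lam - d) * ‖𝓕 g η‖ₑ ≤ (M (lam - d) + N) * Xnorm d α g :=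
    lintegral_enorm_rpow_mul_le (by linarith) hgc.enorm.measurable (hX g) (hX' g)
  have hH1 : ∫⁻ η, H η ≤ C₂ * Xnorm d α g := by
    simp only [H]
    rw [lintegral_const_mul _ (by fun_prop), mul_assoc]
    gcongr
  have hH2 : ∫⁻ η, ‖η‖ₑ ^ (2 * α) * H η ^ 2 ≤ C₃ * Xnorm d α g ^ 2 := by
    have h := lintegral_enorm_rpow_mul_sq_le (s := 2 * (α + (lam - d))) (by linarith)
      (hX g) (hX' g)
    rw [mul_assoc]
    refine le_trans ?_ (mul_le_mul_right h (‖A‖ₑ ^ 2))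
    rw [← lintegral_const_mul _ (by fun_prop)]
    refine lintegral_mono_ae ?_
    filter_upwards [Measure.ae_ne volume (0 : V)] with η hη
    refine le_of_eq ?_
    rw [mul_add, ENNReal.rpow_add _ _ (enorm_ne_zero.2 hη) enorm_ne_top, mul_comm 2 (lam - d),
      ENNReal.rpow_mul _ (lam - d), ENNReal.rpow_two]
    simp only [H]
    ring
  let h : V → ℂ := fun η ↦ (A : ℂ) * (((‖η‖ ^ (lam - d) : ℝ) : ℂ) * 𝓕 g η)
  have hle (η : V) : ‖((‖η‖ ^ (lam - d) : ℝ) : ℂ) * 𝓕 g η‖ₑ ≤ ‖η‖ₑ ^ (lam - d) * ‖𝓕 g η‖ₑ := by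
    rw [enorm_mul, ← ofReal_norm, Complex.norm_real, Real.norm_of_nonneg (by positivity)]
    gcongr
    exact ofReal_norm_rpow_le _ _
  have hĝ : Integrable fun η : V ↦ ((‖η‖ ^ (lam - d) : ℝ) : ℂ) * 𝓕 g η := by
    refine ⟨Measurable.aestronglyMeasurable (by fun_prop), ?_⟩
    refine (lintegral_mono hle).trans_lt (hG1.trans_lt ?_)
    exact ENNReal.mul_lt_top (ENNReal.add_lt_top.2 ⟨(hM (by linarith)).lt_top, hN.lt_top⟩)
      hXg.lt_top
  have hhH (η : V) : ‖h η‖ₑ ≤ H η := by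
    simp only [h, H]
    rw [enorm_mul, ← ofReal_norm, Complex.norm_real, ofReal_norm]
    gcongr
    exact hle η
  have hQ (ξ : V) : 𝓕 (fun v ↦ f v * ∫ w, ((‖v - w‖ ^ (-lam) : ℝ) : ℂ) * g w) ξ =
      ∫ η, h η * 𝓕 f (ξ - η) := by
    rw [← fourier_mul_fourierInv hf (hĝ.const_mul _), Real.fourier_eq, Real.fourier_eq]
    refine integral_congr_ae ?_
    have hae := ae_riesz_potential_eq_fourierInv (V := V) hlam0 (by rwa [hn]) hg (by rwa [hn])
    filter_upwards [hae] with v hv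
    rw [hv]
    simp only [hn, A, Real.fourierInv_eq, ← integral_const_mul, Circle.smul_def, smul_eq_mul,
      mul_left_comm]
  have hQ' (ξ : V) : ‖𝓕 (fun v ↦ f v * ∫ w, ((‖v - w‖ ^ (-lam) : ℝ) : ℂ) * g w) ξ‖ₑ ≤
      ∫⁻ η, H η * ‖𝓕 f (ξ - η)‖ₑ := by
    rw [hQ]
    refine (enorm_integral_le_lintegral_enorm _).trans (lintegral_mono fun η ↦ ?_)
    rw [enorm_mul]
    gcongr
    exact hhH η
  have hsq : He d α (fun v ↦ f v * ∫ w, ((‖v - w‖ ^ (-lam) : ℝ) : ℂ) * g w) ^ 2 ≤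
      C₄ * (Xnorm d α f * Xnorm d α g) ^ 2 := by
    rw [He_sq]
    calc _ ≤ ∫⁻ ξ, ‖ξ‖ₑ ^ (2 * α) * (∫⁻ η, H η * ‖𝓕 f (ξ - η)‖ₑ) ^ 2 := by
          gcongr with ξ
          exact hQ' ξ
      _ ≤ _ := lintegral_enorm_rpow_mul_sq_lintegral_le hα0 hHm hfc.enorm.measurable
      _ ≤ (2 ^ α) ^ 2 * 2 * ((C₁ * Xnorm d α f) ^ 2 * (C₃ * Xnorm d α g ^ 2)) +
          (2 ^ α) ^ 2 * 2 * ((C₂ * Xnorm d α g) ^ 2 * Xnorm d α f ^ 2) := by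
          gcongr
          exact hX' f
      _ = _ := by
          simp only [C₄]
          ring
  have hroot (x : ℝ≥0∞) : (x ^ 2) ^ (1 / 2 : ℝ) = x := by
    rw [← ENNReal.rpow_two, ← ENNReal.rpow_mul]
    norm_num
  have := ENNReal.rpow_le_rpow hsq (z := 1 / 2) (by norm_num)
  rwa [ENNReal.mul_rpow_of_nonneg _ _ (by norm_num), hroot, hroot, ← mul_assoc] at this

theorem stmt12 (d : ℕ) (hd : 1 ≤ d) (lam α : ℝ) (hlam0 : 0 < lam) (hlamd : lam < d)
    (hα : α > (d : ℝ) / 2) (b : ℝ → ℝ) (hb : ∀ x, 0 ≤ b x) :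
    ∃ C : ℝ≥0, 0 < C ∧ ∀ f g : EuclideanSpace ℝ (Fin d) → ℂ,
      Integrable f → Integrable g → He d α f ≠ ⊤ → He d α g ≠ ⊤ →
      ∀ k : EuclideanSpace ℝ (Fin d), ‖k‖ = 1 →
        He d α (Qminus d (bL1 d b k).toReal lam f g) ≤
          C * bL1 d b k * Xnorm d α f * Xnorm d α g := by
  obtain ⟨C, hC, h⟩ := exists_He_mul_riesz_le d hd lam α hlam0 hlamd hα
  refine ⟨C.toNNReal + 1, by positivity, fun f g hf hg _ hgα k _ ↦ ?_⟩
  have hQ : Qminus d (bL1 d b k).toReal lam f g = fun v ↦ ((bL1 d b k).toReal : ℂ) *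
      (f v * ∫ w, ((‖v - w‖ ^ (-lam) : ℝ) : ℂ) * g w) := by
    ext v
    rw [Qminus, mul_assoc]
  have hc : ‖((bL1 d b k).toReal : ℂ)‖ₑ ≤ bL1 d b k := by
    rw [← ofReal_norm, Complex.norm_real, Real.norm_of_nonneg ENNReal.toReal_nonneg]
    exact ENNReal.ofReal_toReal_le
  have hC' : C ≤ ((C.toNNReal + 1 : ℝ≥0) : ℝ≥0∞) := by
    rw [ENNReal.coe_add, ENNReal.coe_toNNReal hC]
    exact le_self_add
  calc He d α (Qminus d (bL1 d b k).toReal lam f g)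
      ≤ bL1 d b k * (((C.toNNReal + 1 : ℝ≥0) : ℝ≥0∞) * Xnorm d α f * Xnorm d α g) := by
        rw [hQ, He_const_mul]
        exact mul_le_mul' hc ((h f g hf hg hgα).trans (by gcongr))
    _ = _ := by ring
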